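/- arXiv:1911.10936 — 3 statements merged into one kernel-verified Lean document; each statement's English description precedes it below -/
import Mathlib

section
/- For every x ∈ ℝ⁴, Λ(r, x^o) = O(r²) as r → 0 (indeed there is a constant C, depending on x, with |Λ(r, x^o)| ≤ C r² for all |r| ≤ 1), and consequently for every t ∈ [0,T] the function r ↦ e^{−(T−t) r²} Λ(r, x^o) r^{−2} is Lebesgue integrable on ℝ, so that u^T(t,x) is well defined. -/
open MeasureTheory Finset

noncomputable section

/-- The 2π-periodic square wave ψ(r) = sign(sin r). -/
def psi (r : ℝ) : ℝ := Real.sign (Real.sin r)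

/-- The vectors α_k ∈ ℝ⁴, α_{k,j} = 3/√2 if k = j and −1/√2 otherwise. -/
def alph : Fin 4 → Fin 4 → ℝ := fun k j => if k = j then 3 / Real.sqrt 2 else -(1 / Real.sqrt 2)

/-- The vector θ = (1/√2)(1,1,−1,−1) ∈ ℝ⁴. -/
def theta : Fin 4 → ℝ :=
  ![1 / Real.sqrt 2, 1 / Real.sqrt 2, -(1 / Real.sqrt 2), -(1 / Real.sqrt 2)]

/-- Euclidean dot product on ℝ⁴. -/
def dot (a b : Fin 4 → ℝ) : ℝ := ∑ j, a j * b j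

/-- The auxiliary function Λ(r,x). -/
def Lam (r : ℝ) (x : Fin 4 → ℝ) : ℝ :=
  psi (r * dot theta x + Real.pi / 2) * (∑ k, Real.cos (r * dot (alph k) x)) - 4
    - psi (r * dot theta x) * (∑ k, Real.sin (r * dot (alph k) x))

/-- x^o : the increasing rearrangement of the coordinates of x. -/
def sortv (x : Fin 4 → ℝ) : Fin 4 → ℝ := fun i => x (Tuple.sort x i)

/-- The function u^T(t,x). -/
def u (T t : ℝ) (x : Fin 4 → ℝ) : ℝ :=
  -(1 / (16 * Real.sqrt 2)) *
      (∫ r : ℝ, Real.exp (-(T - t) * r ^ 2) * Lam r (sortv x) / r ^ 2)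
    + (1 / 4) * ∑ i, x i + (1 / 2) * Real.sqrt ((T - t) * Real.pi / 2)

/-- Partial derivative in the i-th coordinate. -/
def pd (i : Fin 4) (f : (Fin 4 → ℝ) → ℝ) (x : Fin 4 → ℝ) : ℝ :=
  deriv (fun s => f (Function.update x i s)) (x i)

theorem aux_sin (y : ℝ) : |Real.sin y - y| ≤ 2 * y ^ 2 := by
  have h0 : |Real.sin y| ≤ |y| := Real.abs_sin_le_abs
  rcases le_total |y| 1 with h | h
  · have h1 := Real.sin_bound h
    have h2 : |Real.sin y - y| ≤ |Real.sin y - (y - y ^ 3 / 6)| + |y ^ 3 / 6| := by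
      have : Real.sin y - y = (Real.sin y - (y - y ^ 3 / 6)) + (-(y ^ 3 / 6)) := by ring
      rw [this]
      refine (abs_add_le _ _).trans ?_
      rw [abs_neg]
    rw [abs_div, abs_pow, abs_of_pos (by norm_num : (0:ℝ) < 6)] at h2
    have ha := abs_nonneg y
    have h3 : |y| ^ 3 ≤ |y| ^ 2 := pow_le_pow_of_le_one ha h (by norm_num)
    have h4 : |y| ^ 5 ≤ |y| ^ 2 := pow_le_pow_of_le_one ha h (by norm_num)
    rw [← sq_abs y]
    have := sq_nonneg |y|
    linarith
  · have h2 : |Real.sin y - y| ≤ |Real.sin y| + |y| := abs_sub _ _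
    rw [← sq_abs y]
    nlinarith

theorem aux_sign (y : ℝ) : |Real.sign y| ≤ 1 := by
  rcases Real.sign_apply_eq y with h | h | h <;> rw [h] <;> norm_num

theorem aux_meas : Measurable psi := by
  have h : Measurable Real.sign := by
    unfold Real.sign
    exact Measurable.ite measurableSet_Iio measurable_const
      (Measurable.ite measurableSet_Ioi measurable_const measurable_const)
  exact h.comp Real.measurable_sin

theorem aux_sumcos (a : Fin 4 → ℝ) : |∑ k, Real.cos (a k)| ≤ 4 := by
  refine (Finset.abs_sum_le_sum_abs _ _).trans ?_
  refine (Finset.sum_le_sum (fun k _ => Real.abs_cos_le_one (a k))).trans ?_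
  simp

theorem aux_sumsin (a : Fin 4 → ℝ) : |∑ k, Real.sin (a k)| ≤ 4 := by
  refine (Finset.abs_sum_le_sum_abs _ _).trans ?_
  refine (Finset.sum_le_sum (fun k _ => Real.abs_sin_le_one (a k))).trans ?_
  simp

theorem aux_mul {a b c : ℝ} (ha : |a| ≤ 1) (hb : |b| ≤ c) : |a * b| ≤ c := by
  rw [abs_mul]
  nlinarith [abs_nonneg a, abs_nonneg b]

theorem aux_bdd (r : ℝ) (x : Fin 4 → ℝ) : |Lam r x| ≤ 12 := by
  unfold Lam
  have h1 := aux_mul (aux_sign (Real.sin (r * dot theta x + Real.pi / 2)))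
    (aux_sumcos (fun k => r * dot (alph k) x))
  have h2 := aux_mul (aux_sign (Real.sin (r * dot theta x)))
    (aux_sumsin (fun k => r * dot (alph k) x))
  unfold psi
  rw [abs_le] at *
  constructor <;> linarith [h1.1, h1.2, h2.1, h2.2]

theorem aux_sum0 (x : Fin 4 → ℝ) : ∑ k, dot (alph k) x = 0 := by
  simp [dot, alph, Fin.sum_univ_four]
  ring

theorem aux_quad (x : Fin 4 → ℝ) : ∃ C : ℝ, ∀ r : ℝ, |Lam r x| ≤ C * r ^ 2 := by
  refine ⟨12 * (dot theta x) ^ 2 + 3 * ∑ k, (dot (alph k) x) ^ 2, fun r => ?_⟩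
  have hS : 0 ≤ ∑ k, (dot (alph k) x) ^ 2 := Finset.sum_nonneg (fun k _ => sq_nonneg _)
  have hr := sq_nonneg r
  rcases lt_or_ge |r * dot theta x| 1 with h | h
  · have hpi := Real.pi_gt_three
    rw [abs_lt] at h
    have hp : psi (r * dot theta x + Real.pi / 2) = 1 := by
      unfold psi
      rw [Real.sin_add_pi_div_two]
      exact Real.sign_of_pos (Real.cos_pos_of_mem_Ioo ⟨by linarith, by linarith⟩)
    have hc : |(∑ k, Real.cos (r * dot (alph k) x)) - 4| ≤ (∑ k, (dot (alph k) x) ^ 2) * r ^ 2 := by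
      have e : (∑ k, Real.cos (r * dot (alph k) x)) - 4
          = ∑ k, (Real.cos (r * dot (alph k) x) - 1) := by
        simp [Finset.sum_sub_distrib]
      rw [e, Finset.sum_mul]
      refine (Finset.abs_sum_le_sum_abs _ _).trans (Finset.sum_le_sum fun k _ => ?_)
      have h1 := Real.one_sub_sq_div_two_le_cos (x := r * dot (alph k) x)
      have h2 := Real.cos_le_one (r * dot (alph k) x)
      rw [abs_le]
      constructor <;> nlinarith [sq_nonneg (r * dot (alph k) x)]
    have hs : |∑ k, Real.sin (r * dot (alph k) x)| ≤ 2 * (∑ k, (dot (alph k) x) ^ 2) * r ^ 2 := by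
      have e : ∑ k, Real.sin (r * dot (alph k) x)
          = ∑ k, (Real.sin (r * dot (alph k) x) - r * dot (alph k) x) := by
        rw [Finset.sum_sub_distrib, ← Finset.mul_sum, aux_sum0]
        ring
      rw [e, Finset.mul_sum, Finset.sum_mul]
      refine (Finset.abs_sum_le_sum_abs _ _).trans (Finset.sum_le_sum fun k _ => ?_)
      refine (aux_sin _).trans (le_of_eq ?_)
      ring
    have h2 := aux_mul (aux_sign (Real.sin (r * dot theta x))) hs
    unfold Lam
    rw [hp, one_mul]
    unfold psi
    refine (abs_sub _ _).trans ?_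
    nlinarith [mul_nonneg (sq_nonneg (dot theta x)) hr]
  · have h1 := aux_bdd r x
    have h2 : 1 ≤ (r * dot theta x) ^ 2 := by
      rw [← sq_abs]
      nlinarith
    nlinarith [mul_nonneg hS hr]

/-- Λ(r, x^o) = O(r²) near 0, and the integrand of u^T is integrable on ℝ,
so u^T is well defined. -/
theorem lam_quadratic_and_integrable (T : ℝ) (hT : 0 < T) (x : Fin 4 → ℝ) :
    (∃ C : ℝ, ∀ r : ℝ, |r| ≤ 1 → |Lam r (sortv x)| ≤ C * r ^ 2) ∧
    ∀ t ∈ Set.Icc (0 : ℝ) T,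
      Integrable (fun r : ℝ => Real.exp (-(T - t) * r ^ 2) * Lam r (sortv x) / r ^ 2) := by
  obtain ⟨C, hC⟩ := aux_quad (sortv x)
  refine ⟨⟨C, fun r _ => hC r⟩, fun t ht => ?_⟩
  refine Integrable.mono' (integrable_inv_one_add_sq.const_mul (C + 12)) ?_ ?_
  · have hm := aux_meas
    have : Measurable (fun r : ℝ => Lam r (sortv x)) := by
      unfold Lam
      fun_prop
    exact Measurable.aestronglyMeasurable (by fun_prop)
  · refine Filter.Eventually.of_forall fun r => ?_
    have h1 := hC r
    have h2 := aux_bdd r (sortv x)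
    have hC0 : 0 ≤ C := by
      have := (abs_nonneg _).trans (hC 1)
      linarith
    rcases eq_or_ne r 0 with rfl | hr
    · simp
      linarith
    have hr2 : 0 < r ^ 2 := by positivity
    have he : Real.exp (-(T - t) * r ^ 2) ≤ 1 := by
      rw [Real.exp_le_one_iff]
      nlinarith [ht.2]
    have he0 := Real.exp_pos (-(T - t) * r ^ 2)
    rw [Real.norm_eq_abs, abs_div, abs_of_pos hr2, ← div_eq_mul_inv,
      div_le_div_iff₀ hr2 (by positivity)]
    have h3 : |Real.exp (-(T - t) * r ^ 2) * Lam r (sortv x)| ≤ |Lam r (sortv x)| :=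
      aux_mul (by rw [abs_of_pos he0]; exact he) le_rfl
    nlinarith

end
end

section
/- The terminal condition holds: for every x ∈ ℝ⁴, u^T(T, x) = max_{1≤i≤4} x_i. -/
open MeasureTheory Finset

noncomputable section

def KK (d r : ℝ) : ℝ := (1 - Real.cos (d * r)) / r ^ 2

lemma KK_nonneg (d r : ℝ) : 0 ≤ KK d r :=
  div_nonneg (by linarith [Real.cos_le_one (d * r)]) (sq_nonneg _)

lemma KK_le (d r : ℝ) : KK d r ≤ (d ^ 2 / 2 + 2) * (1 + r ^ 2)⁻¹ := by
  unfold KK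
  rcases eq_or_ne r 0 with rfl | hr
  · simp; positivity
  have h0 : 0 < r ^ 2 := by positivity
  rw [← div_eq_mul_inv, div_le_div_iff₀ h0 (by positivity)]
  have h1 := Real.one_sub_sq_div_two_le_cos (x := d * r)
  have h2 := Real.neg_one_le_cos (d * r)
  nlinarith

lemma KK_meas (d : ℝ) : Measurable (KK d) := by unfold KK; fun_prop

lemma KK_int (d : ℝ) : Integrable (KK d) := by
  refine (integrable_inv_one_add_sq.const_mul (d ^ 2 / 2 + 2)).mono'
    (KK_meas d).aestronglyMeasurable (Filter.Eventually.of_forall fun r => ?_)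
  rw [Real.norm_of_nonneg (KK_nonneg d r)]
  exact KK_le d r

lemma int_t (r : ℝ) (hr : 0 < r) : ∫ t in Set.Ioi (0:ℝ), t * Real.exp (-(r * t)) = 1 / r ^ 2 := by
  have := Real.integral_rpow_mul_exp_neg_mul_Ioi (a := 2) (r := r) (by norm_num) hr
  norm_num at this
  simpa using this

lemma int_r (t : ℝ) (ht : 0 < t) :
    ∫ r in Set.Ioi (0:ℝ), t * Real.exp (-(r * t)) * (1 - Real.cos r) = (1 + t ^ 2)⁻¹ := by
  have h1 := integral_exp_mul_Ioi (a := -t) (by linarith) 0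
  have h2 := integral_exp_mul_complex_Ioi (a := ⟨-t, 1⟩) (by simpa using ht) 0
  have i1 := integrableOn_exp_mul_Ioi (a := -t) (by linarith) 0
  have i2 := integrableOn_exp_mul_complex_Ioi (a := ⟨-t, 1⟩) (by simpa using ht) 0
  have e : ∀ r : ℝ, (Complex.exp (⟨-t, 1⟩ * r)).re = Real.exp (-t * r) * Real.cos r := by
    intro r; simp [Complex.exp_re]
  have h3 : ∫ r in Set.Ioi (0:ℝ), Real.exp (-t * r) * Real.cos r = t / (1 + t ^ 2) := by
    have := integral_re (𝕜 := ℂ) i2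
    rw [h2] at this
    simp only [RCLike.re_to_complex, e] at this
    rw [this]
    simp [Complex.div_re, Complex.normSq]
    ring
  have i3 : IntegrableOn (fun r => Real.exp (-t * r) * Real.cos r) (Set.Ioi (0:ℝ)) := by
    have := i2.re
    simp only [RCLike.re_to_complex, e] at this
    exact this
  have : ∀ r : ℝ, t * Real.exp (-(r * t)) * (1 - Real.cos r) =
      t * (Real.exp (-t * r) - Real.exp (-t * r) * Real.cos r) := by
    intro r; rw [show -(r*t) = -t * r by ring]; ring
  simp_rw [this]
  rw [integral_const_mul, integral_sub i1 i3, h1, h3]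
  simp
  field_simp
  ring

lemma base_half : ∫ r in Set.Ioi (0:ℝ), KK 1 r = Real.pi / 2 := by
  have key : ∫ r in Set.Ioi (0:ℝ), ∫ t in Set.Ioi (0:ℝ), t * Real.exp (-(r * t)) * (1 - Real.cos r)
      = ∫ t in Set.Ioi (0:ℝ), ∫ r in Set.Ioi (0:ℝ), t * Real.exp (-(r * t)) * (1 - Real.cos r) := by
    apply integral_integral_swap
    have hm : AEStronglyMeasurable (Function.uncurry fun r t : ℝ => t * Real.exp (-(r * t)) * (1 - Real.cos r))
      ((volume.restrict (Set.Ioi (0:ℝ))).prod (volume.restrict (Set.Ioi (0:ℝ)))) := by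
      apply Continuous.aestronglyMeasurable
      unfold Function.uncurry
      fun_prop
    rw [integrable_prod_iff hm]
    constructor
    · refine (ae_restrict_iff' measurableSet_Ioi).2 (Filter.Eventually.of_forall fun r hr => ?_)
      have : Integrable (fun t : ℝ => t * Real.exp (-(r * t))) (volume.restrict (Set.Ioi 0)) := by
        by_contra h
        have h2 := int_t r hr
        rw [integral_undef h] at h2
        have : 0 < 1 / r ^ 2 := by have : 0 < r := hr; positivity
        linarith
      exact this.mul_const (1 - Real.cos r)
    · refine (KK_int 1).integrableOn.congr ?_
      refine (ae_restrict_iff' measurableSet_Ioi).2 (Filter.Eventually.of_forall fun r hr => ?_)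
      have : ∫ t in Set.Ioi (0:ℝ), ‖t * Real.exp (-(r * t)) * (1 - Real.cos r)‖ =
          ∫ t in Set.Ioi (0:ℝ), t * Real.exp (-(r * t)) * (1 - Real.cos r) := by
        refine setIntegral_congr_fun measurableSet_Ioi fun t ht => ?_
        have h0 : 0 < t := ht
        have := Real.cos_le_one r
        exact Real.norm_of_nonneg (mul_nonneg (by positivity) (by linarith))
      simp only [Function.uncurry]
      rw [this, integral_mul_const, int_t r hr, KK]
      simp; ring
  have e1 : ∫ r in Set.Ioi (0:ℝ), KK 1 r = ∫ r in Set.Ioi (0:ℝ), ∫ t in Set.Ioi (0:ℝ), t * Real.exp (-(r * t)) * (1 - Real.cos r) := by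
    refine setIntegral_congr_fun measurableSet_Ioi fun r hr => ?_
    rw [integral_mul_const, int_t r hr, KK]
    simp; ring
  have e2 : ∫ t in Set.Ioi (0:ℝ), ∫ r in Set.Ioi (0:ℝ), t * Real.exp (-(r * t)) * (1 - Real.cos r) = ∫ t in Set.Ioi (0:ℝ), (1 + t ^ 2)⁻¹ :=
    setIntegral_congr_fun measurableSet_Ioi fun t ht => int_r t ht
  rw [e1, key, e2, integral_Ioi_inv_one_add_sq]
  simp

lemma base : ∫ r, KK 1 r = Real.pi := by
  have := integral_comp_abs (f := KK 1)
  rw [base_half] at this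
  have e : ∀ r, KK 1 |r| = KK 1 r := by intro r; simp [KK, Real.cos_abs]
  simp_rw [e] at this
  linarith

lemma KK_integral (a : ℝ) : ∫ r, KK a r = Real.pi * |a| := by
  rcases eq_or_ne a 0 with rfl | ha
  · simp [KK]
  have := Measure.integral_comp_mul_left (KK 1) a
  rw [base] at this
  have e : ∀ r, KK a r = a ^ 2 * KK 1 (a * r) := by
    intro r; unfold KK; field_simp
  simp_rw [e]
  rw [integral_const_mul, this, abs_inv, smul_eq_mul, ← sq_abs a]
  have : |a| ≠ 0 := by simpa
  field_simp

/-- real cosine transform -/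
lemma KK_cos (d b : ℝ) : ∫ r, KK d r * Real.cos (b * r) =
    Real.pi * (-|b| + |b + d| / 2 + |b - d| / 2) := by
  have e : ∀ r, KK d r * Real.cos (b * r) = -KK b r + KK (b + d) r / 2 + KK (b - d) r / 2 := by
    intro r
    simp only [KK, add_mul, sub_mul, Real.cos_add, Real.cos_sub]
    ring
  simp_rw [e]
  have i1 : Integrable (fun r => -KK b r) := (KK_int b).neg
  have i2 : Integrable (fun r => KK (b + d) r / 2) := (KK_int _).div_const 2
  have i3 : Integrable (fun r => KK (b - d) r / 2) := (KK_int _).div_const 2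
  have i4 : Integrable (fun r => -KK b r + KK (b + d) r / 2) := i1.add i2
  rw [integral_add i4 i3, integral_add i1 i2, integral_neg, integral_div, integral_div]
  simp only [KK_integral]
  ring

lemma KK_sin (d b : ℝ) : ∫ r, KK d r * Real.sin (b * r) = 0 := by
  have := integral_neg_eq_self (fun r => KK d r * Real.sin (b * r)) volume
  have e : ∀ r, KK d (-r) * Real.sin (b * -r) = - (KK d r * Real.sin (b * r)) := by
    intro r; simp [KK]
  simp_rw [e] at this
  rw [integral_neg] at this
  linarith

lemma int_mul_bdd (d C : ℝ) (φ : ℝ → ℂ) (hc : Continuous φ) (hb : ∀ r, ‖φ r‖ ≤ C) :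
    Integrable (fun r => (KK d r : ℂ) * φ r) := by
  exact (KK_int d).ofReal.mul_bdd hc.aestronglyMeasurable (Filter.Eventually.of_forall hb)

instance factpi : Fact (0 < Real.pi) := ⟨Real.pi_pos⟩

def Lfun (d : ℝ) : C(AddCircle Real.pi, ℂ) →ₗ[ℂ] ℂ where
  toFun φ := (∫ r : ℝ, (KK d r : ℂ) * φ (r : AddCircle Real.pi))
    - d * ∫ r in (0:ℝ)..Real.pi, φ (r : AddCircle Real.pi)
  map_add' φ χ := by
    have h := fun φ : C(AddCircle Real.pi, ℂ) => int_mul_bdd d ‖φ‖ (fun r => φ (r : AddCircle Real.pi))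
      (by exact φ.continuous.comp (AddCircle.continuous_mk' _)) (fun r => φ.norm_coe_le_norm _)
    have h2 : ∀ φ : C(AddCircle Real.pi, ℂ), IntervalIntegrable
        (fun r : ℝ => φ (r : AddCircle Real.pi)) volume 0 Real.pi := fun φ =>
      (φ.continuous.comp (AddCircle.continuous_mk' Real.pi)).intervalIntegrable (μ := volume) 0 Real.pi
    simp only [ContinuousMap.add_apply, mul_add]
    rw [integral_add (h φ) (h χ), intervalIntegral.integral_add (h2 φ) (h2 χ)]
    ring
  map_smul' c φ := by
    simp only [ContinuousMap.smul_apply, smul_eq_mul, RingHom.id_apply]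
    rw [intervalIntegral.integral_const_mul]
    simp_rw [mul_left_comm _ c]
    rw [integral_const_mul]
    ring

def Lclm (d : ℝ) : C(AddCircle Real.pi, ℂ) →L[ℂ] ℂ :=
  (Lfun d).mkContinuous ((∫ r, KK d r) + |d| * Real.pi) (by
    intro φ
    have h1 : ‖∫ r : ℝ, (KK d r : ℂ) * φ (r : AddCircle Real.pi)‖ ≤ (∫ r, KK d r) * ‖φ‖ := by
      rw [← integral_mul_const]
      refine norm_integral_le_of_norm_le ((KK_int d).mul_const _)
        (Filter.Eventually.of_forall fun r => ?_)
      rw [norm_mul, Complex.norm_real, Real.norm_of_nonneg (KK_nonneg d r)]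
      exact mul_le_mul_of_nonneg_left (φ.norm_coe_le_norm _) (KK_nonneg d r)
    have h2 : ‖∫ r in (0:ℝ)..Real.pi, φ (r : AddCircle Real.pi)‖ ≤ ‖φ‖ * |Real.pi - 0| :=
      intervalIntegral.norm_integral_le_of_norm_le_const (fun r _ => φ.norm_coe_le_norm _)
    rw [sub_zero, abs_of_pos Real.pi_pos] at h2
    calc _ ≤ ‖∫ r : ℝ, (KK d r : ℂ) * φ (r : AddCircle Real.pi)‖ +
        ‖(d:ℂ) * ∫ r in (0:ℝ)..Real.pi, φ (r : AddCircle Real.pi)‖ := norm_sub_le _ _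
      _ ≤ _ := by
        rw [norm_mul, Complex.norm_real, Real.norm_eq_abs]
        have := mul_le_mul_of_nonneg_left h2 (abs_nonneg d)
        nlinarith)

lemma Lclm_zero (d : ℝ) (h0 : 0 ≤ d) (h2 : d ≤ 2) : Lclm d = 0 := by
  refine ContinuousLinearMap.ext_on (s := Set.range (@fourier Real.pi)) ?_ ?_
  · have := span_fourier_closure_eq_top (T := Real.pi)
    rw [dense_iff_closure_eq, ← Submodule.topologicalClosure_coe, this]; rfl
  · rintro _ ⟨n, rfl⟩
    show (∫ r : ℝ, (KK d r : ℂ) * fourier n (r : AddCircle Real.pi))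
      - d * ∫ r in (0:ℝ)..Real.pi, fourier n (r : AddCircle Real.pi) = 0
    have hpi : (Real.pi : ℂ) ≠ 0 := by exact_mod_cast Real.pi_ne_zero
    have e : ∀ r : ℝ, fourier n (r : AddCircle Real.pi) = Complex.exp ((2 * n * Complex.I) * r) := by
      intro r
      rw [fourier_coe_apply]
      congr 1
      field_simp
    have e2 : ∀ r : ℝ, (KK d r : ℂ) * Complex.exp ((2 * n * Complex.I) * r) =
        ((KK d r * Real.cos ((2 * n : ℝ) * r) : ℝ) : ℂ) + ((KK d r * Real.sin ((2 * n : ℝ) * r) : ℝ) : ℂ) * Complex.I := by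
      intro r
      rw [show (2 * n * Complex.I) * (r:ℂ) = ((2 * n * r : ℝ) : ℂ) * Complex.I by push_cast; ring,
        Complex.exp_mul_I]
      push_cast; ring
    have i1 : Integrable (fun r => ((KK d r * Real.cos ((2 * n : ℝ) * r) : ℝ) : ℂ)) := by
      apply Integrable.ofReal
      exact (KK_int d).mul_bdd (c := 1) (by fun_prop) (Filter.Eventually.of_forall fun r => Real.abs_cos_le_one _)
    have i2 : Integrable (fun r => ((KK d r * Real.sin ((2 * n : ℝ) * r) : ℝ) : ℂ) * Complex.I) := by
      apply Integrable.mul_const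
      apply Integrable.ofReal
      exact (KK_int d).mul_bdd (c := 1) (by fun_prop) (Filter.Eventually.of_forall fun r => Real.abs_sin_le_one _)
    simp_rw [e]
    have e3 : ∫ r : ℝ, (KK d r : ℂ) * Complex.exp ((2 * n * Complex.I) * r) =
        ((Real.pi * (-|(2 * n : ℝ)| + |(2 * n : ℝ) + d| / 2 + |(2 * n : ℝ) - d| / 2) : ℝ) : ℂ) := by
      simp_rw [e2]
      rw [integral_add i1 i2, integral_mul_const, integral_complex_ofReal, integral_complex_ofReal, KK_sin, KK_cos]
      simp
    rw [e3]
    rcases eq_or_ne n 0 with rfl | hn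
    · simp [abs_of_nonneg h0]; ring
    · have hn' : (n : ℂ) ≠ 0 := by exact_mod_cast hn
      rw [integral_exp_mul_complex (by simp [hn'])]
      have : Complex.exp (2 * n * Complex.I * Real.pi) = 1 := by
        rw [Complex.exp_eq_one_iff]; exact ⟨n, by ring⟩
      rw [this]
      have : -|(2 * n : ℝ)| + |(2 * n : ℝ) + d| / 2 + |(2 * n : ℝ) - d| / 2 = 0 := by
        rcases lt_or_gt_of_ne hn with h | h
        · have : (n : ℝ) ≤ -1 := by exact_mod_cast (by omega : n ≤ -1)
          rw [abs_of_nonpos, abs_of_nonpos, abs_of_nonpos] <;> linarith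
        · have : (1 : ℝ) ≤ n := by exact_mod_cast (by omega : 1 ≤ n)
          rw [abs_of_nonneg, abs_of_nonneg, abs_of_nonneg] <;> linarith
      rw [this]
      simp

lemma fold (d : ℝ) (h0 : 0 ≤ d) (h2 : d ≤ 2) (φ : ℝ → ℝ) (hc : Continuous φ)
    (hp : Function.Periodic φ Real.pi) :
    ∫ r, KK d r * φ r = d * ∫ r in (0:ℝ)..Real.pi, φ r := by
  have hp' : Function.Periodic (fun r => (φ r : ℂ)) Real.pi := fun r => by simp [hp r]
  have hc' : Continuous hp'.lift := by
    apply continuous_coinduced_dom.mpr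
    show Continuous (fun r : ℝ => (φ r : ℂ))
    fun_prop
  have := congrArg (fun L => L ⟨hp'.lift, hc'⟩) (Lclm_zero d h0 h2)
  have h : (∫ r : ℝ, (KK d r : ℂ) * (φ r : ℂ)) - d * ∫ r in (0:ℝ)..Real.pi, (φ r : ℂ) = 0 := this
  rw [intervalIntegral.integral_ofReal] at h
  simp_rw [← Complex.ofReal_mul] at h
  rw [integral_complex_ofReal] at h
  have h3 := sub_eq_zero.mp h
  exact_mod_cast h3

lemma per_cos : Function.Periodic (fun r => |Real.cos r|) Real.pi := fun r => by simp [Real.cos_add_pi]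
lemma per_sin : Function.Periodic (fun r => |Real.sin r|) Real.pi := fun r => by simp [Real.sin_add_pi]

lemma shift (φ : ℝ → ℝ) (hp : Function.Periodic φ Real.pi) :
    ∫ r in (0:ℝ)..Real.pi, φ r = ∫ r in (-(Real.pi/2))..(Real.pi/2), φ r := by
  have := hp.intervalIntegral_add_eq 0 (-(Real.pi/2))
  rw [zero_add, show -(Real.pi/2) + Real.pi = Real.pi/2 by ring] at this
  exact this

lemma int_cos : ∫ r in (0:ℝ)..Real.pi, |Real.cos r| = 2 := by
  rw [shift _ per_cos]
  have : ∫ r in (-(Real.pi/2))..(Real.pi/2), |Real.cos r| = ∫ r in (-(Real.pi/2))..(Real.pi/2), Real.cos r := by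
    refine intervalIntegral.integral_congr fun r hr => ?_
    rw [Set.uIcc_of_le (by linarith [Real.pi_pos])] at hr
    exact abs_of_nonneg (Real.cos_nonneg_of_mem_Icc hr)
  rw [this, integral_cos]; simp; norm_num

lemma int_sin : ∫ r in (0:ℝ)..Real.pi, |Real.sin r| = 2 := by
  have : ∫ r in (0:ℝ)..Real.pi, |Real.sin r| = ∫ r in (0:ℝ)..Real.pi, Real.sin r := by
    refine intervalIntegral.integral_congr fun r hr => ?_
    rw [Set.uIcc_of_le (by linarith [Real.pi_pos])] at hr
    exact abs_of_nonneg (Real.sin_nonneg_of_mem_Icc hr)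
  rw [this, integral_sin]; simp; norm_num

lemma int_inv : ∫ r in (0:ℝ)..Real.pi, (1 + |Real.cos r|)⁻¹ = 2 := by
  rw [shift _ (fun r => by simp [Real.cos_add_pi])]
  have h : ∀ r ∈ Set.uIcc (-(Real.pi/2)) (Real.pi/2), 0 ≤ Real.cos r := by
    intro r hr
    rw [Set.uIcc_of_le (by linarith [Real.pi_pos])] at hr
    exact Real.cos_nonneg_of_mem_Icc hr
  rw [intervalIntegral.integral_eq_sub_of_hasDerivAt (f := fun r => Real.sin r / (1 + Real.cos r))]
  · simp; norm_num
  · intro r hr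
    have h1 := h r hr
    have h2 : 1 + Real.cos r ≠ 0 := by positivity
    have := (Real.hasDerivAt_sin r).div ((Real.hasDerivAt_cos r).const_add 1) h2
    convert! this using 1
    rw [abs_of_nonneg h1]
    field_simp
    nlinarith [Real.sin_sq_add_cos_sq r]
  · apply Continuous.intervalIntegrable
    refine Continuous.inv₀ (by fun_prop) fun r => ?_
    positivity

lemma main1 (d e : ℝ) (h0 : 0 ≤ d) (h2 : d ≤ 2) (k0 : 0 ≤ e) (k2 : e ≤ 2) :
    ∫ r, (2 * Real.cos (d * r) * (|Real.cos r| - |Real.sin r|)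
      + 2 * Real.cos (e * r) * (|Real.cos r| + |Real.sin r|) - 4) / r ^ 2 = -8 * (1 + e) := by
  have hi : ∀ d C : ℝ, ∀ φ : ℝ → ℝ, Continuous φ → (∀ r, |φ r| ≤ C) → Integrable (fun r => KK d r * φ r) :=
    fun d C φ hc hb => (KK_int d).mul_bdd (c := C) hc.aestronglyMeasurable (Filter.Eventually.of_forall hb)
  have cinv : Continuous (fun r => (1 + |Real.cos r|)⁻¹) :=
    Continuous.inv₀ (by fun_prop) fun r => by positivity
  have f1 := fold d h0 h2 (fun r => |Real.cos r| - |Real.sin r|) (by fun_prop) (per_cos.sub per_sin)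
  have f2 := fold e k0 k2 (fun r => |Real.cos r| + |Real.sin r|) (by fun_prop) (per_cos.add per_sin)
  have f3 := fold 2 (by norm_num) le_rfl (fun r => (1 + |Real.cos r|)⁻¹) cinv (fun r => by simp [Real.cos_add_pi])
  have ic : IntervalIntegrable (fun r => |Real.cos r|) volume 0 Real.pi :=
    Continuous.intervalIntegrable (by fun_prop) _ _
  have is : IntervalIntegrable (fun r => |Real.sin r|) volume 0 Real.pi :=
    Continuous.intervalIntegrable (by fun_prop) _ _
  rw [intervalIntegral.integral_sub ic is, int_cos, int_sin] at f1
  rw [intervalIntegral.integral_add ic is, int_cos, int_sin] at f2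
  rw [int_inv] at f3
  have i1 := hi d 2 (fun r => |Real.cos r| - |Real.sin r|) (by fun_prop) (fun r => by
    rw [abs_le]; constructor <;> linarith [Real.abs_cos_le_one r, Real.abs_sin_le_one r, abs_nonneg (Real.cos r), abs_nonneg (Real.sin r)])
  have i2 := hi e 2 (fun r => |Real.cos r| + |Real.sin r|) (by fun_prop) (fun r => by
    rw [abs_le]; constructor <;> linarith [Real.abs_cos_le_one r, Real.abs_sin_le_one r, abs_nonneg (Real.cos r), abs_nonneg (Real.sin r)])
  have i3 := hi 2 1 (fun r => (1 + |Real.cos r|)⁻¹) cinv (fun r => by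
    rw [abs_of_nonneg (by positivity)]
    exact inv_le_one_of_one_le₀ (by linarith [abs_nonneg (Real.cos r)]))
  have key : ∀ r, (2 * Real.cos (d * r) * (|Real.cos r| - |Real.sin r|)
      + 2 * Real.cos (e * r) * (|Real.cos r| + |Real.sin r|) - 4) / r ^ 2 =
      (-2) * ((KK d r * (|Real.cos r| - |Real.sin r|)) + (KK e r * (|Real.cos r| + |Real.sin r|))
       + (KK 2 r * (1 + |Real.cos r|)⁻¹)) := by
    intro r
    have h : (1 - Real.cos (2 * r)) * (1 + |Real.cos r|)⁻¹ = 2 * (1 - |Real.cos r|) := by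
      have : 1 + |Real.cos r| ≠ 0 := by positivity
      rw [Real.cos_two_mul, ← sq_abs]
      field_simp
      ring
    have h' : KK 2 r * (1 + |Real.cos r|)⁻¹ = 2 * (1 - |Real.cos r|) / r ^ 2 := by
      rw [← h, KK]; ring
    rw [h']
    unfold KK
    ring
  simp_rw [key]
  have i12 : Integrable (fun r => KK d r * (|Real.cos r| - |Real.sin r|) +
      KK e r * (|Real.cos r| + |Real.sin r|)) := i1.add i2
  rw [integral_const_mul, integral_add i12 i3, integral_add i1 i2, f1, f2, f3]
  ring

lemma main2 (c d e : ℝ) (hc : 0 ≤ c) (h0 : 0 ≤ d) (k0 : 0 ≤ e) (h : d + e ≤ 2 * c) :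
    ∫ r, (2 * Real.cos (d * r) * (|Real.cos (c * r)| - |Real.sin (c * r)|)
      + 2 * Real.cos (e * r) * (|Real.cos (c * r)| + |Real.sin (c * r)|) - 4) / r ^ 2 = -8 * (c + e) := by
  rcases hc.eq_or_lt with rfl | hc
  · have : d = 0 := by linarith
    have : e = 0 := by linarith
    subst_vars
    norm_num
  have m := main1 (d / c) (e / c) (by positivity) (by rw [div_le_iff₀ hc]; linarith)
    (by positivity) (by rw [div_le_iff₀ hc]; linarith)
  have s := Measure.integral_comp_mul_left (fun r => (2 * Real.cos (d / c * r) * (|Real.cos r| - |Real.sin r|)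
      + 2 * Real.cos (e / c * r) * (|Real.cos r| + |Real.sin r|) - 4) / r ^ 2) c
  rw [m] at s
  have key : ∀ r, (2 * Real.cos (d * r) * (|Real.cos (c * r)| - |Real.sin (c * r)|)
      + 2 * Real.cos (e * r) * (|Real.cos (c * r)| + |Real.sin (c * r)|) - 4) / r ^ 2 =
      c ^ 2 * ((2 * Real.cos (d / c * (c * r)) * (|Real.cos (c * r)| - |Real.sin (c * r)|)
      + 2 * Real.cos (e / c * (c * r)) * (|Real.cos (c * r)| + |Real.sin (c * r)|) - 4) / (c * r) ^ 2) := by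
    intro r
    rw [show d / c * (c * r) = d * r by field_simp, show e / c * (c * r) = e * r by field_simp]
    field_simp
  simp_rw [key]
  rw [integral_const_mul, s, abs_of_pos (by positivity), smul_eq_mul]
  field_simp

lemma sgn_mul (a : ℝ) : Real.sign a * a = |a| := by
  rcases lt_trichotomy a 0 with h | rfl | h
  · rw [Real.sign_of_neg h, abs_of_neg h]; ring
  · simp
  · rw [Real.sign_of_pos h, abs_of_pos h]; ring

lemma Lam_eq (z : Fin 4 → ℝ) (r q c d e : ℝ) (hq : q = 1 / Real.sqrt 2)
    (hc : c = q * (z 2 + z 3 - z 0 - z 1)) (hd : d = 2 * q * (z 1 - z 0))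
    (he : e = 2 * q * (z 3 - z 2)) :
    Lam r z = 2 * Real.cos (d * r) * (|Real.cos (c * r)| - |Real.sin (c * r)|)
      + 2 * Real.cos (e * r) * (|Real.cos (c * r)| + |Real.sin (c * r)|) - 4 := by
  have hth : r * dot theta z = -(c * r) := by
    simp only [dot, theta, Fin.sum_univ_four, hc]
    simp [← hq]
    simp only [hq]
    ring
  have h0 : r * dot (alph 0) z = -(c * r) - d * r := by
    rw [hc, hd, hq]; simp [dot, alph, Fin.sum_univ_four]; ring
  have h1 : r * dot (alph 1) z = -(c * r) + d * r := by
    rw [hc, hd, hq]; simp [dot, alph, Fin.sum_univ_four]; ring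
  have h2 : r * dot (alph 2) z = c * r - e * r := by
    rw [hc, he, hq]; simp [dot, alph, Fin.sum_univ_four]; ring
  have h3 : r * dot (alph 3) z = c * r + e * r := by
    rw [hc, he, hq]; simp [dot, alph, Fin.sum_univ_four]; ring
  unfold Lam psi
  simp only [Fin.sum_univ_four, hth, h0, h1, h2, h3]
  rw [Real.sin_add_pi_div_two, Real.cos_neg, Real.sin_neg, ← sgn_mul (Real.cos (c * r)),
    ← sgn_mul (Real.sin (c * r)), Real.sign_neg]
  simp only [Real.cos_add, Real.cos_sub, Real.sin_add, Real.sin_sub, Real.cos_neg, Real.sin_neg]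
  ring

/-- terminal condition u^T(T,x) = max_i x_i. -/
theorem u_terminal (T : ℝ) (hT : 0 < T) (x : Fin 4 → ℝ) :
    u T T x = Finset.univ.sup' Finset.univ_nonempty x := by
  have hm : Monotone (sortv x) := Tuple.monotone_sort x
  have hsum : ∑ i, x i = ∑ i, sortv x i := (Equiv.sum_comp (Tuple.sort x) x).symm
  have hsup : Finset.univ.sup' Finset.univ_nonempty x = sortv x 3 := by
    apply le_antisymm
    · refine Finset.sup'_le _ _ fun i _ => ?_
      have : x i = sortv x ((Tuple.sort x).symm i) := by simp [sortv]
      rw [this]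
      exact hm (Fin.le_last _)
    · exact Finset.le_sup' x (Finset.mem_univ _)
  rw [hsup, u, hsum]
  generalize sortv x = z at hm
  have h01 : z 0 ≤ z 1 := hm (by decide)
  have h12 : z 1 ≤ z 2 := hm (by decide)
  have h23 : z 2 ≤ z 3 := hm (by decide)
  obtain ⟨q, hq⟩ : ∃ q, q = 1 / Real.sqrt 2 := ⟨_, rfl⟩
  have hqp : 0 < q := by rw [hq]; positivity
  have hq2 : q ^ 2 = 1 / 2 := by rw [hq, div_pow, Real.sq_sqrt (by norm_num)]; norm_num
  have m := main2 (q * (z 2 + z 3 - z 0 - z 1)) (2 * q * (z 1 - z 0)) (2 * q * (z 3 - z 2))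
    (mul_nonneg hqp.le (by linarith)) (mul_nonneg (by linarith) (by linarith))
    (mul_nonneg (by linarith) (by linarith)) (by nlinarith)
  have e : ∀ r, Real.exp (-(T - T) * r ^ 2) * Lam r z / r ^ 2 = Lam r z / r ^ 2 := by
    intro r; simp
  simp_rw [e, fun r => Lam_eq z r q _ _ _ hq rfl rfl rfl]
  rw [m, show 1 / (16 * Real.sqrt 2) = q / 16 by rw [hq]; ring]
  simp only [sub_self, zero_mul, zero_div, Real.sqrt_zero, Fin.sum_univ_four]
  linear_combination (1/2) * (3 * z 3 - z 0 - z 1 - z 2) * hq2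

end
end

section
/- On the diagonal the gradient is uniform: if 0 ≤ t < T and x = (a,a,a,a) for some a ∈ ℝ, then for each i ∈ {1,2,3,4} the partial derivative ∂_{x_i} u^T(t,x) exists and equals 1/4. -/
open MeasureTheory Finset

noncomputable section

theorem psi_mul_aux (c : ℝ) : psi c * Real.sin c ^ 3 = |Real.sin c| ^ 3 := by
  unfold psi
  rcases lt_trichotomy (Real.sin c) 0 with h | h | h
  · rw [Real.sign_of_neg h, abs_of_neg h]; ring
  · simp [h]
  · rw [Real.sign_of_pos h, abs_of_pos h]; ring

theorem psi_neg_aux (c : ℝ) : psi (-c) = - psi c := by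
  unfold psi
  rw [Real.sin_neg, Real.sign_neg]

theorem bound_aux (c d : ℝ) (hd : d = c ∨ d = -c) :
    |psi (d + Real.pi / 2) * (4 * Real.cos c ^ 3) - 4 - psi d * (-4 * Real.sin c ^ 3)|
      ≤ 12 * c ^ 2 := by
  have h1 : psi (d + Real.pi / 2) * Real.cos c ^ 3 = |Real.cos c| ^ 3 := by
    have hc : Real.cos c = Real.sin (d + Real.pi / 2) := by
      rw [Real.sin_add_pi_div_two]
      rcases hd with h | h <;> simp [h]
    rw [hc, psi_mul_aux]
  have h2 : |psi d * Real.sin c ^ 3| ≤ Real.sin c ^ 2 := by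
    have : |psi d * Real.sin c ^ 3| = |Real.sin c| ^ 3 := by
      rcases hd with h | h
      · rw [h, psi_mul_aux]; simp
      · rw [h, psi_neg_aux, neg_mul, psi_mul_aux]; simp
    rw [this, ← sq_abs (Real.sin c)]
    exact pow_le_pow_of_le_one (abs_nonneg _) (Real.abs_sin_le_one c) (by norm_num)
  have h3 : |Real.cos c| ^ 3 ≤ 1 := pow_le_one₀ (abs_nonneg _) (Real.abs_cos_le_one c)
  have h4 : |Real.cos c| ^ 4 ≤ |Real.cos c| ^ 3 :=
    pow_le_pow_of_le_one (abs_nonneg _) (Real.abs_cos_le_one c) (by norm_num)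
  have h5 : |Real.cos c| ^ 4 = (1 - Real.sin c ^ 2) ^ 2 := by
    rw [← Real.cos_sq', ← sq_abs (Real.cos c)]; ring
  have h6 : Real.sin c ^ 2 ≤ c ^ 2 := sq_le_sq.2 (Real.abs_sin_le_abs)
  rw [abs_le] at h2 ⊢
  have h7 := sq_nonneg (Real.sin c ^ 2)
  constructor <;> nlinarith

theorem Lam_bound (a s r : ℝ) (j : Fin 4) :
    |Lam r (Function.update (fun _ : Fin 4 => a) j s)| ≤ 6 * (s - a) ^ 2 * r ^ 2 := by
  set c := r * ((s - a) / Real.sqrt 2) with hc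
  have hd : r * dot theta (Function.update (fun _ : Fin 4 => a) j s) = c ∨
      r * dot theta (Function.update (fun _ : Fin 4 => a) j s) = -c := by
    fin_cases j
    · left; simp [dot, theta, Fin.sum_univ_four, Function.update, hc, -mul_eq_mul_left_iff]; ring
    · left; simp [dot, theta, Fin.sum_univ_four, Function.update, hc, -mul_eq_mul_left_iff]; ring
    · right; simp [dot, theta, Fin.sum_univ_four, Function.update, hc, -mul_eq_mul_left_iff]; ring
    · right; simp [dot, theta, Fin.sum_univ_four, Function.update, hc, -mul_eq_mul_left_iff]; ring
  have hk : ∀ k, r * dot (alph k) (Function.update (fun _ : Fin 4 => a) j s) =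
      if k = j then 3 * c else -c := by
    intro k
    fin_cases j <;> fin_cases k <;>
      simp [dot, alph, Fin.sum_univ_four, Function.update, hc, -mul_eq_mul_left_iff] <;> ring
  have hcos : (∑ k, Real.cos (r * dot (alph k) (Function.update (fun _ : Fin 4 => a) j s)))
      = 4 * Real.cos c ^ 3 := by
    simp only [hk]
    have := Real.cos_three_mul c
    fin_cases j <;> simp [Fin.sum_univ_four] <;> linarith
  have hsin : (∑ k, Real.sin (r * dot (alph k) (Function.update (fun _ : Fin 4 => a) j s)))
      = -4 * Real.sin c ^ 3 := by
    simp only [hk]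
    have := Real.sin_three_mul c
    fin_cases j <;> simp [Fin.sum_univ_four] <;> linarith
  unfold Lam
  rw [hcos, hsin]
  refine (bound_aux c _ hd).trans (le_of_eq ?_)
  rw [hc, mul_pow, div_pow, Real.sq_sqrt (by norm_num)]
  ring

theorem sortv_aux (a s : ℝ) (i : Fin 4) : ∃ j : Fin 4,
    sortv (Function.update (fun _ : Fin 4 => a) i s) = Function.update (fun _ : Fin 4 => a) j s := by
  set x := Function.update (fun _ : Fin 4 => a) i s with hx
  have key : ∀ j : Fin 4, Monotone (Function.update (fun _ : Fin 4 => a) j s) →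
      sortv x = Function.update (fun _ : Fin 4 => a) j s := by
    intro j hm
    have e : x ∘ (Equiv.swap i j) = Function.update (fun _ : Fin 4 => a) j s := by
      funext k
      simp only [hx, Function.comp, Function.update_apply]
      congr 1
      rw [Equiv.swap_apply_eq_iff, Equiv.swap_apply_left]
    rw [← e] at hm ⊢
    exact (Tuple.comp_sort_eq_comp_iff_monotone.2 hm).symm
  rcases le_total a s with h | h
  · refine ⟨3, key 3 ?_⟩
    intro p q hpq
    fin_cases p <;> fin_cases q <;> simp_all [Function.update]
  · refine ⟨0, key 0 ?_⟩
    intro p q hpq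
    fin_cases p <;> fin_cases q <;> simp_all [Function.update]

/-- on the diagonal x = (a,a,a,a), each partial derivative of u^T equals 1/4. -/
theorem u_first_partial_diagonal (T t : ℝ) (ht : 0 ≤ t) (htT : t < T) (a : ℝ) (i : Fin 4) :
    HasDerivAt (fun s => u T t (Function.update (fun _ : Fin 4 => a) i s)) (1 / 4) a := by
  set I : ℝ → ℝ := fun s => ∫ r : ℝ, Real.exp (-(T - t) * r ^ 2) *
    Lam r (sortv (Function.update (fun _ : Fin 4 => a) i s)) / r ^ 2 with hI
  have hb : ∀ s, ‖I s‖ ≤ (∫ r : ℝ, Real.exp (-(T - t) * r ^ 2) * 6) * ‖‖s - a‖ ^ 2‖ := by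
    intro s
    obtain ⟨j, hj⟩ := sortv_aux a s i
    rw [← integral_mul_const]
    refine norm_integral_le_of_norm_le
      (((integrable_exp_neg_mul_sq (sub_pos.2 htT)).mul_const _).mul_const _)
      (Filter.Eventually.of_forall fun r => ?_)
    rw [hj, norm_div, norm_mul, Real.norm_of_nonneg (Real.exp_pos _).le,
      Real.norm_of_nonneg (sq_nonneg r)]
    have hn : ‖‖s - a‖ ^ 2‖ = (s - a) ^ 2 := by simp
    rw [hn]
    refine div_le_of_le_mul₀ (sq_nonneg r) (by positivity) ?_
    have := mul_le_mul_of_nonneg_left (Lam_bound a s r j) (Real.exp_pos (-(T - t) * r ^ 2)).le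
    rw [Real.norm_eq_abs]
    linarith
  have hO : I =O[nhds a] fun s => ‖s - a‖ ^ 2 :=
    Asymptotics.IsBigO.of_bound _ (Filter.Eventually.of_forall hb)
  have hD : HasDerivAt I 0 a := by
    have := (hO.hasFDerivAt (𝕜 := ℝ) (by norm_num)).hasDerivAt
    simpa using this
  have hsum : HasDerivAt (fun s => ∑ k, Function.update (fun _ : Fin 4 => a) i s k) 1 a := by
    have : (fun s => ∑ k, Function.update (fun _ : Fin 4 => a) i s k) = fun s => s + 3 * a := by
      funext s
      fin_cases i <;> simp [Fin.sum_univ_four, Function.update] <;> ring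
    rw [this]
    exact (hasDerivAt_id a).add_const _
  have := ((hD.const_mul (-(1 / (16 * Real.sqrt 2)))).add (hsum.const_mul (1 / 4))).add_const
    ((1 / 2) * Real.sqrt ((T - t) * Real.pi / 2))
  have h2 := this.congr_deriv (g' := 1 / 4) (by simp)
  exact h2

end
end
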